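/- Let w ∈ W have an Ṡ_n-admissible presentation w = τ_{k_1}^{i_{k_1}}·τ_{k_2}^{i_{k_2}}⋯τ_{k_m}^{i_{k_m}}. Then the Coxeter length of w satisfies ℓ(w) = Σ_{j=1}^m k_j·i_{k_j}, as an equality of integers (in particular the right-hand side is nonnegative). -/

import Mathlib

/-- The Coxeter matrix of type `Bₙ`, with the bond of order `4` between the
generators of indices `0` and `1` (the paper's convention): `s_i² = 1`,
`(s_0·s_1)⁴ = 1`, `(s_i·s_{i+1})³ = 1` for `1 ≤ i ≤ n-2`, and `(s_i·s_j)² = 1`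
for `|i-j| ≥ 2`. -/
def BCoxeterMatrix (n : ℕ) : CoxeterMatrix (Fin n) where
  M := Matrix.of fun i j : Fin n ↦
    if i = j then 1
      else if ((i : ℕ) = 0 ∧ (j : ℕ) = 1) ∨ ((j : ℕ) = 0 ∧ (i : ℕ) = 1) then 4
      else if (j : ℕ) + 1 = i ∨ (i : ℕ) + 1 = j then 3 else 2
  isSymm := by unfold Matrix.IsSymm; aesop
  diagonal := by simp
  off_diagonal := by aesop

variable {n : ℕ} {W : Type*} [Group W]

/-- The simple reflection `s_j` of the Coxeter system, for `0 ≤ j ≤ n-1`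
(junk value `1` for `j ≥ n`). -/
def sgen (cs : CoxeterSystem (BCoxeterMatrix n) W) (j : ℕ) : W :=
  if h : j < n then cs.simple ⟨j, h⟩ else 1

/-- `tau cs k` is the element `τ_k = s_0 · s_1 ⋯ s_{k-1}` (with `τ_0 = 1`). -/
def tau (cs : CoxeterSystem (BCoxeterMatrix n) W) (k : ℕ) : W :=
  ((List.range k).map (sgen cs)).prod

/-- An `Ṡ_n`-admissible presentation of `w ∈ W`: an expression
`w = τ_{k_1}^{i_{k_1}} ⋯ τ_{k_m}^{i_{k_m}}` with `1 ≤ k_1 < ⋯ < k_m ≤ n` and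
nonzero integers `i_{k_j}` such that `-k_j ≤ i_{k_j} ≤ k_j - 1` for all `j`,
`Σ_{j=1}^m i_{k_j} = 0`, and `0 ≤ Σ_{j=r}^m i_{k_j} ≤ k_{r-1}` for all `2 ≤ r ≤ m`. -/
structure IsAdmissible (cs : CoxeterSystem (BCoxeterMatrix n) W) (w : W)
    (m : ℕ) (k : Fin m → ℕ) (i : Fin m → ℤ) : Prop where
  one_le : ∀ j, 1 ≤ k j
  le_n : ∀ j, k j ≤ n
  mono : StrictMono k
  ne_zero : ∀ j, i j ≠ 0
  lb : ∀ j, -(k j : ℤ) ≤ i j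
  ub : ∀ j, i j ≤ (k j : ℤ) - 1
  total : ∑ j, i j = 0
  partialSum : ∀ r : ℕ, 1 ≤ r → ∀ hr : r < m,
    0 ≤ (∑ j ∈ Finset.univ.filter (fun j : Fin m => r ≤ (j : ℕ)), i j) ∧
    (∑ j ∈ Finset.univ.filter (fun j : Fin m => r ≤ (j : ℕ)), i j) ≤
      (k ⟨r - 1, Nat.lt_of_le_of_lt (Nat.sub_le r 1) hr⟩ : ℤ)
  prod_eq : w = ((List.finRange m).map (fun j => tau cs (k j) ^ i j)).prod

/-- The permutation of `ℕ` which the `j`-th simple reflection induces when signs are forgotten. -/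
def unsignedSwap (j : ℕ) : Equiv.Perm ℕ := if j = 0 then 1 else Equiv.swap j (j + 1)

theorem unsignedSwap_mul_self (j : ℕ) : unsignedSwap j * unsignedSwap j = 1 := by
  unfold unsignedSwap; split_ifs <;> simp

theorem unsignedSwap_isLiftable (n : ℕ) :
    (BCoxeterMatrix n).IsLiftable fun j : Fin n ↦ unsignedSwap j := by
  intro i j
  have key : ∀ a b : ℕ, ((unsignedSwap a * unsignedSwap b) ^ (if a = b then 1
      else if (a = 0 ∧ b = 1) ∨ (b = 0 ∧ a = 1) then 4
      else if b + 1 = a ∨ a + 1 = b then 3 else 2) = 1) := by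
    intro a b
    split_ifs with h1 h2 h3
    · subst h1; simp [unsignedSwap_mul_self]
    · rcases h2 with ⟨rfl, rfl⟩ | ⟨rfl, rfl⟩ <;> simp [unsignedSwap, pow_succ]
    · ext x
      simp only [unsignedSwap, pow_succ, pow_zero, Equiv.Perm.mul_apply, Equiv.Perm.one_apply,
        one_mul, show a ≠ 0 by omega, show b ≠ 0 by omega, if_false, Equiv.swap_apply_def]
      grind
    · ext x
      by_cases ha : a = 0
      · simp [ha, unsignedSwap, pow_succ, apply_ite]
      by_cases hb : b = 0
      · simp [hb, unsignedSwap, pow_succ]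
      simp only [unsignedSwap, pow_succ, pow_zero, Equiv.Perm.mul_apply, Equiv.Perm.one_apply,
        one_mul, ha, hb, if_false, Equiv.swap_apply_def]
      grind
  have := key i j
  simpa [BCoxeterMatrix, Fin.ext_iff] using this

/-- The homomorphism from the Coxeter group of type `Bₙ` to permutations forgetting signs. -/
def toPerm (cs : CoxeterSystem (BCoxeterMatrix n) W) : W →* Equiv.Perm ℕ :=
  cs.lift ⟨_, unsignedSwap_isLiftable n⟩

theorem toPerm_simple (cs : CoxeterSystem (BCoxeterMatrix n) W) (j : Fin n) :
    toPerm cs (cs.simple j) = unsignedSwap j :=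
  cs.lift_apply_simple (unsignedSwap_isLiftable n) j

theorem toPerm_sgen (cs : CoxeterSystem (BCoxeterMatrix n) W) {j : ℕ} (h1 : 1 ≤ j) (hn : j < n) :
    toPerm cs (sgen cs j) = Equiv.swap j (j + 1) := by
  simp [sgen, hn, toPerm_simple, unsignedSwap, show j ≠ 0 by omega]

/-- The inversions `(p, q)` of a permutation with `p < q ≤ n`. -/
def permInversions (n : ℕ) (σ : Equiv.Perm ℕ) : Finset (ℕ × ℕ) :=
  (Finset.range (n + 1) ×ˢ Finset.range (n + 1)).filter fun p ↦ p.1 < p.2 ∧ σ p.2 < σ p.1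

theorem mem_permInversions {σ : Equiv.Perm ℕ} {p : ℕ × ℕ} :
    p ∈ permInversions n σ ↔ p.1 < p.2 ∧ p.2 ≤ n ∧ σ p.2 < σ p.1 := by
  simp only [permInversions, Finset.mem_filter, Finset.mem_product, Finset.mem_range]
  omega

theorem card_permInversions_mul_swap_le (σ : Equiv.Perm ℕ) {j : ℕ} (hj : j < n) :
    (permInversions n (σ * Equiv.swap j (j + 1))).card ≤ (permInversions n σ).card + 1 := by
  have hsub : permInversions n (σ * Equiv.swap j (j + 1)) ⊆ insert (j, j + 1)
      ((permInversions n σ).image (Prod.map (Equiv.swap j (j + 1)) (Equiv.swap j (j + 1)))) := by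
    rintro ⟨p, q⟩ h
    rw [mem_permInversions] at h
    simp only [Equiv.Perm.mul_apply] at h
    obtain ⟨h1, h2, h3⟩ := h
    rw [Finset.mem_insert, Finset.mem_image]
    by_cases hpq : p = j ∧ q = j + 1
    · simp [hpq]
    · refine Or.inr ⟨(Equiv.swap j (j + 1) p, Equiv.swap j (j + 1) q), ?_, by simp⟩
      rw [mem_permInversions]
      refine ⟨?_, ?_, h3⟩ <;> simp only [Equiv.swap_apply_def] <;> split_ifs <;> omega
  refine (Finset.card_le_card hsub).trans ((Finset.card_insert_le _ _).trans ?_)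
  exact Nat.add_le_add_right Finset.card_image_le 1

theorem card_permInversions_lt_mul_swap (σ : Equiv.Perm ℕ) {j : ℕ} (hj : j < n)
    (hσ : σ j < σ (j + 1)) :
    (permInversions n σ).card + 1 ≤ (permInversions n (σ * Equiv.swap j (j + 1))).card := by
  have hinj : Function.Injective (Prod.map (Equiv.swap j (j + 1)) (Equiv.swap j (j + 1))) :=
    (Equiv.injective _).prodMap (Equiv.injective _)
  have hmem : ∀ p q, (p, q) ∈ permInversions n σ →
      Equiv.swap j (j + 1) p < Equiv.swap j (j + 1) q ∧ Equiv.swap j (j + 1) q ≤ n := by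
    intro p q h
    rw [mem_permInversions] at h
    simp only at h
    have : ¬ (p = j ∧ q = j + 1) := by rintro ⟨rfl, rfl⟩; omega
    constructor <;> simp only [Equiv.swap_apply_def] <;> split_ifs <;> omega
  rw [← Finset.card_image_of_injective _ hinj, ← Finset.card_insert_of_notMem (a := (j, j + 1))]
  · apply Finset.card_le_card
    intro x hx
    rw [Finset.mem_insert, Finset.mem_image] at hx
    rcases hx with rfl | ⟨⟨p, q⟩, h, rfl⟩
    · rw [mem_permInversions]
      simpa using ⟨hj, hσ⟩
    · have h' := hmem p q h
      rw [mem_permInversions] at h ⊢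
      exact ⟨h'.1, h'.2, by simpa using h.2.2⟩
  · rw [Finset.mem_image]
    rintro ⟨⟨p, q⟩, h, he⟩
    simp only [Prod.map_apply, Prod.mk.injEq, Equiv.swap_apply_eq_iff,
      Equiv.swap_apply_left, Equiv.swap_apply_right] at he
    rw [mem_permInversions] at h
    simp only at h
    omega

theorem card_permInversions_toPerm_le_length (cs : CoxeterSystem (BCoxeterMatrix n) W) (w : W) :
    (permInversions n (toPerm cs w)).card ≤ cs.length w := by
  obtain ⟨ω, hω, rfl⟩ := cs.exists_isReduced w
  rw [hω]
  clear hω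
  induction ω using List.reverseRecOn with
  | nil =>
    simp only [CoxeterSystem.wordProd_nil, map_one, List.length_nil, Nat.le_zero,
      Finset.card_eq_zero]
    ext p
    simp only [mem_permInversions, Equiv.Perm.one_apply, Finset.notMem_empty, iff_false]
    omega
  | append_singleton ω j ih =>
    rw [CoxeterSystem.wordProd_append, CoxeterSystem.wordProd_singleton, map_mul, toPerm_simple,
      List.length_append, List.length_singleton]
    unfold unsignedSwap
    split_ifs
    · simp only [mul_one]; omega
    · exact (card_permInversions_mul_swap_le _ j.2).trans (Nat.add_le_add_right ih 1)

section Relations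

variable (cs : CoxeterSystem (BCoxeterMatrix n) W)

theorem sgen_mul_self (j : ℕ) : sgen cs j * sgen cs j = 1 := by
  unfold sgen; split_ifs <;> simp

theorem sgen_inv (j : ℕ) : (sgen cs j)⁻¹ = sgen cs j :=
  inv_eq_of_mul_eq_one_left (sgen_mul_self cs j)

theorem sgen_mul_comm {i j : ℕ} (h : i + 2 ≤ j) : sgen cs i * sgen cs j = sgen cs j * sgen cs i := by
  by_cases hj : j < n
  · have hi : i < n := by omega
    have := cs.simple_mul_simple_pow ⟨i, hi⟩ ⟨j, hj⟩
    have hM : (BCoxeterMatrix n).M ⟨i, hi⟩ ⟨j, hj⟩ = 2 := by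
      simp only [BCoxeterMatrix, Matrix.of_apply, Fin.mk.injEq]
      grind
    rw [hM] at this
    have h2 : (sgen cs i * sgen cs j) ^ 2 = 1 := by simpa [sgen, hi, hj] using this
    have := eq_inv_of_mul_eq_one_left (pow_two (sgen cs i * sgen cs j) ▸ h2)
    rwa [mul_inv_rev, sgen_inv, sgen_inv] at this
  · simp [sgen, hj]

theorem sgen_braid {i : ℕ} (h1 : 1 ≤ i) (hn : i + 1 < n) :
    sgen cs i * sgen cs (i + 1) * sgen cs i = sgen cs (i + 1) * sgen cs i * sgen cs (i + 1) := by
  have hi : i < n := by omega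
  have := cs.simple_mul_simple_pow ⟨i, hi⟩ ⟨i + 1, hn⟩
  have hM : (BCoxeterMatrix n).M ⟨i, hi⟩ ⟨i + 1, hn⟩ = 3 := by
    simp only [BCoxeterMatrix, Matrix.of_apply, Fin.mk.injEq]
    grind
  rw [hM] at this
  have h3 : (sgen cs i * sgen cs (i + 1) * sgen cs i) *
      (sgen cs (i + 1) * sgen cs i * sgen cs (i + 1)) = 1 := by
    simpa [sgen, hi, hn, pow_succ, mul_assoc] using this
  have := eq_inv_of_mul_eq_one_left h3
  simpa only [mul_inv_rev, sgen_inv, mul_assoc] using this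

theorem tau_succ (k : ℕ) : tau cs (k + 1) = tau cs k * sgen cs k := by
  simp [tau, List.range_succ]

theorem tau_mul_sgen_comm {k j : ℕ} (h : k < j) : tau cs k * sgen cs j = sgen cs j * tau cs k := by
  induction k with
  | zero => simp [tau]
  | succ k ih =>
    rw [tau_succ, mul_assoc, sgen_mul_comm cs (by omega), ← mul_assoc, ih (by omega), mul_assoc]

theorem tau_mul_sgen {b i : ℕ} (h1 : 1 ≤ i) (hb : i + 2 ≤ b) (hn : b ≤ n) :
    tau cs b * sgen cs i = sgen cs (i + 1) * tau cs b := by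
  induction b, hb using Nat.le_induction with
  | base =>
    rw [tau_succ, tau_succ]
    calc tau cs i * sgen cs i * sgen cs (i + 1) * sgen cs i
        = tau cs i * (sgen cs i * sgen cs (i + 1) * sgen cs i) := by simp only [mul_assoc]
      _ = (tau cs i * sgen cs (i + 1)) * sgen cs i * sgen cs (i + 1) := by
        rw [sgen_braid cs h1 (by omega)]; simp only [mul_assoc]
      _ = _ := by rw [tau_mul_sgen_comm cs (by omega)]; simp only [mul_assoc]
  | succ b hb ih =>
    rw [tau_succ, mul_assoc, ← sgen_mul_comm cs hb, ← mul_assoc, ih (by omega), mul_assoc]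

/-- The product `s_a · s_{a+1} ⋯ s_{a+c-1}`. -/
def sgenRun (a c : ℕ) : W := ((List.range' a c).map (sgen cs)).prod

theorem sgenRun_zero (a : ℕ) : sgenRun cs a 0 = 1 := by simp [sgenRun]

theorem sgenRun_succ (a c : ℕ) : sgenRun cs a (c + 1) = sgenRun cs a c * sgen cs (a + c) := by
  simp [sgenRun, List.range'_concat]

theorem tau_add (a c : ℕ) : tau cs (a + c) = tau cs a * sgenRun cs a c := by
  induction c with
  | zero => simp [sgenRun_zero]
  | succ c ih => rw [← add_assoc, tau_succ, ih, sgenRun_succ, mul_assoc]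

theorem tau_mul_sgenRun {a c b : ℕ} (h1 : 1 ≤ a) (hb : a + c < b) (hn : b ≤ n) :
    tau cs b * sgenRun cs a c = sgenRun cs (a + 1) c * tau cs b := by
  induction c with
  | zero => simp [sgenRun_zero]
  | succ c ih =>
    rw [sgenRun_succ, sgenRun_succ, ← mul_assoc, ih (by omega), mul_assoc,
      tau_mul_sgen cs (by omega) (by omega) hn, mul_assoc, Nat.add_right_comm]

theorem sgenRun_mul_tau_pow {a c r : ℕ} (hr : r < a) (hn : a + c ≤ n) :
    sgenRun cs a c * tau cs (a + c) ^ r = tau cs (a + c) ^ r * sgenRun cs (a - r) c := by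
  induction r with
  | zero => simp
  | succ r ih =>
    obtain ⟨d, rfl⟩ : ∃ d, a = d + 1 + r := ⟨a - r - 1, by omega⟩
    rw [pow_succ, ← mul_assoc, ih (by omega), mul_assoc, mul_assoc,
      show d + 1 + r - r = d + 1 by omega, show d + 1 + r - (r + 1) = d by omega,
      tau_mul_sgenRun cs (by omega) (by omega) hn]

theorem tau_pow_inv_mul_tau_pow_succ {a c r : ℕ} (hr : r < a) (hn : a + c ≤ n) :
    (tau cs a ^ (r + 1))⁻¹ * tau cs (a + c) ^ (r + 1) =
      (tau cs a ^ r)⁻¹ * tau cs (a + c) ^ r * sgenRun cs (a - r) c := by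
  have h : tau cs (a + c) ^ (r + 1) = tau cs a * (tau cs (a + c) ^ r * sgenRun cs (a - r) c) := by
    rw [← sgenRun_mul_tau_pow cs hr hn, pow_succ', ← mul_assoc, ← tau_add]
  rw [h, pow_succ']
  group

end Relations

/-- `u` has length at most `L` and its underlying unsigned permutation has at least `L`
inversions. -/
def LengthWitness (cs : CoxeterSystem (BCoxeterMatrix n) W) (u : W) (L : ℕ) : Prop :=
  cs.length u ≤ L ∧ L ≤ (permInversions n (toPerm cs u)).card

section LengthWitness

variable {cs : CoxeterSystem (BCoxeterMatrix n) W} {u : W} {L : ℕ}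

theorem LengthWitness.length_eq (h : LengthWitness cs u L) : cs.length u = L :=
  le_antisymm h.1 (h.2.trans (card_permInversions_toPerm_le_length cs u))

theorem LengthWitness.mul_sgen (h : LengthWitness cs u L) {j : ℕ} (h1 : 1 ≤ j) (hn : j < n)
    (hasc : toPerm cs u j < toPerm cs u (j + 1)) : LengthWitness cs (u * sgen cs j) (L + 1) := by
  constructor
  · refine (cs.length_mul_le _ _).trans (Nat.add_le_add h.1 ?_)
    simp [sgen, hn]
  · rw [map_mul, toPerm_sgen cs h1 hn]
    exact (Nat.add_le_add_right h.2 1).trans (card_permInversions_lt_mul_swap _ hn hasc)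

theorem LengthWitness.mul_sgenRun (h : LengthWitness cs u L) {a c : ℕ} (h1 : 1 ≤ a)
    (hn : a + c ≤ n)
    (hasc : ∀ p, a < p → p ≤ a + c → toPerm cs u a < toPerm cs u p) :
    LengthWitness cs (u * sgenRun cs a c) (L + c) ∧
      ∀ p, toPerm cs (u * sgenRun cs a c) p =
        toPerm cs u (if p < a ∨ a + c < p then p else if p = a + c then a else p + 1) := by
  induction c with
  | zero =>
    refine ⟨by simpa [sgenRun_zero] using h, fun p ↦ ?_⟩
    rw [sgenRun_zero, mul_one]
    congr 1
    grind
  | succ c ih =>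
    obtain ⟨ih1, ih2⟩ := ih (by omega) fun p hp hp' ↦ hasc p hp (by omega)
    rw [sgenRun_succ, ← mul_assoc]
    constructor
    · refine ih1.mul_sgen (by omega) (by omega) ?_
      rw [ih2, ih2]
      simpa using hasc (a + c + 1) (by omega) (by omega)
    · intro p
      rw [map_mul, toPerm_sgen cs (by omega) (by omega), Equiv.Perm.mul_apply, ih2]
      congr 1
      simp only [Equiv.swap_apply_def]
      grind

theorem LengthWitness.mul_tau_pow (h : LengthWitness cs u L) {a c : ℕ} (hn : a + c ≤ n)
    (hfix : ∀ p, a < p → toPerm cs u p = p) (r : ℕ) (hr : r ≤ a) :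
    LengthWitness cs (u * ((tau cs a ^ r)⁻¹ * tau cs (a + c) ^ r)) (L + r * c) ∧
      (∀ p, a + c < p → toPerm cs (u * ((tau cs a ^ r)⁻¹ * tau cs (a + c) ^ r)) p = p) ∧
      (∀ p, p ≤ a - r → toPerm cs (u * ((tau cs a ^ r)⁻¹ * tau cs (a + c) ^ r)) p ≤ a) ∧
      ∀ p, a - r < p → p ≤ a - r + c →
        a < toPerm cs (u * ((tau cs a ^ r)⁻¹ * tau cs (a + c) ^ r)) p := by
  induction r with
  | zero =>
    simp only [pow_zero, inv_one, mul_one, zero_mul, add_zero, Nat.sub_zero]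
    refine ⟨h, fun p hp ↦ hfix p (by omega), fun p hp ↦ ?_, fun p hp _ ↦ by rwa [hfix p hp]⟩
    by_contra! hlt
    have := (toPerm cs u).injective (hfix _ hlt)
    omega
  | succ r ih =>
    obtain ⟨ih1, ih2, ih3, ih4⟩ := ih (by omega)
    rw [tau_pow_inv_mul_tau_pow_succ cs (by omega) hn, ← mul_assoc]
    generalize u * ((tau cs a ^ r)⁻¹ * tau cs (a + c) ^ r) = v at ih1 ih2 ih3 ih4
    obtain ⟨h1, h2⟩ := ih1.mul_sgenRun (a := a - r) (c := c) (by omega) (by omega)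
      fun p hp hp' ↦ (ih3 _ le_rfl).trans_lt (ih4 p hp hp')
    refine ⟨by rwa [Nat.succ_mul, ← add_assoc], fun p hp ↦ ?_, fun p hp ↦ ?_, fun p hp hp' ↦ ?_⟩
    · rw [h2, if_pos (by omega), ih2 p hp]
    · rw [h2, if_pos (by omega)]
      exact ih3 p (by omega)
    · rw [h2, if_neg (by omega), if_neg (by omega)]
      exact ih4 _ (by omega) (by omega)

end LengthWitness

/-- Telescoping the product `τ_{K 0}^{I 0} ⋯ τ_{K t}^{I t}` through the suffix sums of the
exponents. -/
theorem exists_lengthWitness_tauProduct (cs : CoxeterSystem (BCoxeterMatrix n) W) {m : ℕ} {K : ℕ → ℕ}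
    {I : ℕ → ℤ} (hK : ∀ t < m, K t ≤ n) (hmono : ∀ t, t + 1 < m → K t ≤ K (t + 1))
    (htotal : ∑ j ∈ Finset.Ico 0 m, I j = 0)
    (hsum : ∀ t, t + 1 < m → 0 ≤ ∑ j ∈ Finset.Ico (t + 1) m, I j ∧
      ∑ j ∈ Finset.Ico (t + 1) m, I j ≤ K t) (t : ℕ) (ht : t < m) :
    ∃ L : ℕ, (L : ℤ) = ∑ j ∈ Finset.range (t + 1), (K j : ℤ) * I j +
        K t * ∑ j ∈ Finset.Ico (t + 1) m, I j ∧
      LengthWitness cs (((List.range (t + 1)).map fun j ↦ tau cs (K j) ^ I j).prod *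
        tau cs (K t) ^ ∑ j ∈ Finset.Ico (t + 1) m, I j) L ∧
      ∀ p, K t < p → toPerm cs (((List.range (t + 1)).map fun j ↦ tau cs (K j) ^ I j).prod *
        tau cs (K t) ^ ∑ j ∈ Finset.Ico (t + 1) m, I j) p = p := by
  induction t with
  | zero =>
    rw [Finset.sum_eq_sum_Ico_succ_bot ht] at htotal
    refine ⟨0, ?_, ?_⟩
    · simp only [zero_add, Finset.sum_range_one] at *
      rw [← mul_add, htotal]; simp
    · have : ((List.range (0 + 1)).map fun j ↦ tau cs (K j) ^ I j).prod *
          tau cs (K 0) ^ ∑ j ∈ Finset.Ico (0 + 1) m, I j = 1 := by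
        simp only [zero_add, List.range_one, List.map_cons, List.map_nil, List.prod_singleton] at *
        rw [← zpow_add, htotal, zpow_zero]
      rw [this]
      exact ⟨⟨by simp, Nat.zero_le _⟩, fun p _ ↦ by simp⟩
  | succ t ih =>
    obtain ⟨L, hL, hw, hfix⟩ := ih (by omega)
    obtain ⟨h0, hle⟩ := hsum t ht
    obtain ⟨c, hc⟩ := Nat.exists_eq_add_of_le (hmono t ht)
    have hsplit := Finset.sum_eq_sum_Ico_succ_bot ht I
    obtain ⟨r, hr⟩ := Int.eq_ofNat_of_zero_le h0
    have hcn : K t + c ≤ n := hc ▸ hK _ ht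
    obtain ⟨h1, h2, -, -⟩ := hw.mul_tau_pow hcn hfix r (by omega)
    have hprod : ((List.range (t + 1 + 1)).map fun j ↦ tau cs (K j) ^ I j).prod *
          tau cs (K (t + 1)) ^ ∑ j ∈ Finset.Ico (t + 1 + 1) m, I j =
        ((List.range (t + 1)).map fun j ↦ tau cs (K j) ^ I j).prod *
          tau cs (K t) ^ (∑ j ∈ Finset.Ico (t + 1) m, I j) *
          ((tau cs (K t) ^ r)⁻¹ * tau cs (K t + c) ^ r) := by
      rw [List.range_succ (n := t + 1), List.map_append, List.prod_append, List.map_singleton,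
        List.prod_singleton, mul_assoc, ← zpow_add, ← hsplit, hr, hc]
      simp only [zpow_natCast, mul_assoc, mul_inv_cancel_left]
    refine ⟨L + r * c, ?_, ?_, ?_⟩
    · rw [Finset.sum_range_succ, add_assoc, ← mul_add, ← hsplit]
      push_cast
      rw [hL, hr, hc]
      push_cast
      ring
    · rwa [hprod]
    · rwa [hprod, hc]

/-- If `w` has an `Ṡ_n`-admissible presentation `w = τ_{k_1}^{i_{k_1}} ⋯ τ_{k_m}^{i_{k_m}}`,
then `ℓ(w) = Σ_{j=1}^m k_j · i_{k_j}` (as integers). -/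
theorem length_of_admissible (cs : CoxeterSystem (BCoxeterMatrix n) W) (w : W)
    (m : ℕ) (k : Fin m → ℕ) (i : Fin m → ℤ) (h : IsAdmissible cs w m k i) :
    (cs.length w : ℤ) = ∑ j, (k j : ℤ) * i j := by
  rcases m with _ | m
  · simp [h.prod_eq]
  let K : ℕ → ℕ := fun t ↦ if ht : t < m + 1 then k ⟨t, ht⟩ else 0
  let I : ℕ → ℤ := fun t ↦ if ht : t < m + 1 then i ⟨t, ht⟩ else 0
  have hKk : ∀ j : Fin (m + 1), K j = k j := fun j ↦ dif_pos j.2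
  have hIi : ∀ j : Fin (m + 1), I j = i j := fun j ↦ dif_pos j.2
  have hsuffix : ∀ r, ∑ j ∈ Finset.univ.filter (fun j : Fin (m + 1) ↦ r ≤ (j : ℕ)), i j =
      ∑ j ∈ Finset.Ico r (m + 1), I j := by
    intro r
    simp only [← hIi]
    rw [Finset.sum_filter, Fin.sum_univ_eq_sum_range (fun j ↦ if r ≤ j then I j else 0),
      ← Finset.sum_filter]
    congr 1
    ext j
    simp only [Finset.mem_filter, Finset.mem_range, Finset.mem_Ico]
    omega
  obtain ⟨L, hL, hw, -⟩ := exists_lengthWitness_tauProduct cs (m := m + 1) (K := K) (I := I)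
    (fun t ht ↦ hKk ⟨t, ht⟩ ▸ h.le_n ⟨t, ht⟩)
    (fun t ht ↦ by
      rw [hKk ⟨t, by omega⟩, hKk ⟨t + 1, ht⟩]
      exact h.mono.monotone (Fin.mk_le_mk.2 (Nat.le_succ t)))
    (by rw [← hsuffix]; simpa using h.total)
    (fun t ht ↦ by
      have := h.partialSum (t + 1) (by omega) ht
      rw [hsuffix] at this
      rw [hKk ⟨t, by omega⟩]
      exact this) m (Nat.lt_succ_self m)
  have hwprod : w = ((List.range (m + 1)).map fun j ↦ tau cs (K j) ^ I j).prod := by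
    rw [h.prod_eq, ← List.map_coe_finRange_eq_range, List.map_map]
    congr 2
    funext j
    simp [hKk, hIi]
  simp only [Finset.Ico_self, Finset.sum_empty, zpow_zero, mul_one, mul_zero, add_zero] at hL hw
  rw [hwprod, hw.length_eq, hL, ← Fin.sum_univ_eq_sum_range (fun j ↦ (K j : ℤ) * I j)]
  simp only [hKk, hIi]
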